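/- Let d > 0, θ₋, θ₊ ∈ (-1,1), T > 0. Let v : (-1,1) → ℝ be smooth with v'(s) > 0 for all s ∈ (-1,1). Let u : [-d,d] × [0,T] → ℝ be smooth with |u_x| < 1, satisfying u_t = ∂/∂x (v(u_x)) on [-d,d]×[0,T], u_x(-d,t) = θ₋, u_x(d,t) = θ₊ for all t ∈ [0,T], and sup_{y ∈ [-d,d]} |u_x(y,0)| < 1. Then for all x ∈ [-d,d] and all t ∈ [0,T], |u_x(x,t)| ≤ sup_{y ∈ [-d,d]} |u_x(y,0)| < 1. -/

import Mathlib

/-- First spatial partial derivative `u_x`. -/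
noncomputable def ux (u : ℝ → ℝ → ℝ) (x t : ℝ) : ℝ := deriv (fun y => u y t) x

/-- Time partial derivative `u_t`. -/
noncomputable def ut (u : ℝ → ℝ → ℝ) (x t : ℝ) : ℝ := deriv (fun s => u x s) t

open Set Filter Topology

/-- Directional derivative of `F` in the direction `e`, taken within `S`. -/
noncomputable def dirDerivWithin (S : Set (ℝ × ℝ)) (e : ℝ × ℝ) (F : ℝ × ℝ → ℝ) (p : ℝ × ℝ) : ℝ :=
  fderivWithin ℝ F S p e

theorem ContDiffOn.dirDerivWithin {S : Set (ℝ × ℝ)} (hS : UniqueDiffOn ℝ S) (e : ℝ × ℝ)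
    {F : ℝ × ℝ → ℝ} (hF : ContDiffOn ℝ (⊤ : ℕ∞) F S) :
    ContDiffOn ℝ (⊤ : ℕ∞) (dirDerivWithin S e F) S :=
  (hF.fderivWithin hS (m := (⊤ : ℕ∞)) (by simp)).clm_apply contDiffOn_const

theorem dirDerivWithin_comm {S : Set (ℝ × ℝ)} (hS : UniqueDiffOn ℝ S) (e₁ e₂ : ℝ × ℝ)
    {F : ℝ × ℝ → ℝ} (hF : ContDiffOn ℝ (⊤ : ℕ∞) F S) {p : ℝ × ℝ} (hp : p ∈ S)
    (hp' : p ∈ closure (interior S)) :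
    dirDerivWithin S e₁ (dirDerivWithin S e₂ F) p =
      dirDerivWithin S e₂ (dirDerivWithin S e₁ F) p := by
  have hsymm : IsSymmSndFDerivWithinAt ℝ F S p :=
    (hF p hp).isSymmSndFDerivWithinAt (by simpa using WithTop.coe_le_coe.2 (le_top : (2 : ℕ∞) ≤ ⊤)) hS hp' hp
  have key : ∀ e e' : ℝ × ℝ, dirDerivWithin S e (dirDerivWithin S e' F) p =
      fderivWithin ℝ (fderivWithin ℝ F S) S p e e' := by
    intro e e'
    have h1 : HasFDerivWithinAt (fderivWithin ℝ F S) (fderivWithin ℝ (fderivWithin ℝ F S) S p) S p :=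
      (((hF.fderivWithin hS (m := (⊤ : ℕ∞)) (by simp)).differentiableOn (by simp)) p
        hp).hasFDerivWithinAt
    have h2 := h1.clm_apply (hasFDerivWithinAt_const e' p S)
    have h3 := h2.fderivWithin (hS p hp)
    change fderivWithin ℝ (fun q => fderivWithin ℝ F S q e') S p e = _
    rw [h3]
    simp
  rw [key, key]
  exact hsymm e₁ e₂

section Rectangle

variable {I J : Set ℝ} {F : ℝ × ℝ → ℝ} {x t : ℝ}

theorem hasDerivWithinAt_fst (hF : DifferentiableOn ℝ F (I ×ˢ J)) (hx : x ∈ I) (ht : t ∈ J) :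
    HasDerivWithinAt (fun y => F (y, t)) (dirDerivWithin (I ×ˢ J) (1, 0) F (x, t)) I x :=
  HasFDerivWithinAt.comp_hasDerivWithinAt (l := F) (f := fun y => (y, t)) (f' := (1, 0)) x
    (hF (x, t) ⟨hx, ht⟩).hasFDerivWithinAt
    ((hasDerivWithinAt_id x I).prodMk (hasDerivWithinAt_const x I t)) (fun _ hy => ⟨hy, ht⟩)

theorem hasDerivWithinAt_snd (hF : DifferentiableOn ℝ F (I ×ˢ J)) (hx : x ∈ I) (ht : t ∈ J) :
    HasDerivWithinAt (fun s => F (x, s)) (dirDerivWithin (I ×ˢ J) (0, 1) F (x, t)) J t :=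
  HasFDerivWithinAt.comp_hasDerivWithinAt (l := F) (f := fun s => (x, s)) (f' := (0, 1)) t
    (hF (x, t) ⟨hx, ht⟩).hasFDerivWithinAt
    ((hasDerivWithinAt_const t J x).prodMk (hasDerivWithinAt_id t J)) (fun _ hs => ⟨hx, hs⟩)

end Rectangle

section OneVariable

variable {a b : ℝ}

theorem nhdsWithin_Ioo_neBot_of_mem_Icc (hab : a < b) {x : ℝ} (hx : x ∈ Icc a b) :
    (𝓝[Ioo a b] x).NeBot := by
  rw [← mem_closure_iff_nhdsWithin_neBot, closure_Ioo hab.ne]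
  exact hx

theorem second_deriv_nonpos_of_isMaxOn (hab : a < b) {f f' : ℝ → ℝ} {c x₀ : ℝ}
    (hx₀ : x₀ ∈ Icc a b) (hf : ∀ x ∈ Icc a b, HasDerivWithinAt f (f' x) (Icc a b) x)
    (hf' : HasDerivWithinAt f' c (Icc a b) x₀) (h₀ : f' x₀ = 0) (hmax : IsMaxOn f (Icc a b) x₀) :
    c ≤ 0 := by
  by_contra! hc
  have hslope := (hasDerivWithinAt_iff_tendsto_slope.1 hf').eventually (lt_mem_nhds hc)
  obtain ⟨δ, hδ, hpos⟩ := Metric.eventually_nhds_iff.1 (eventually_nhdsWithin_iff.1 hslope)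
  have hsign : ∀ y ∈ Icc a b, y ≠ x₀ → |y - x₀| < δ → 0 < (y - x₀)⁻¹ * f' y := by
    intro y hy hne hlt
    simpa [slope_def_module, h₀] using hpos (y := y) (by rwa [Real.dist_eq]) ⟨hy, hne⟩
  have hcont : ContinuousOn f (Icc a b) := fun x hx => (hf x hx).continuousWithinAt
  have hder : ∀ x ∈ Ioo a b, HasDerivAt f (f' x) x := fun x hx =>
    (hf x (Ioo_subset_Icc_self hx)).hasDerivAt (Icc_mem_nhds hx.1 hx.2)
  rcases hx₀.2.lt_or_eq with hlt | heq
  · obtain ⟨y, hy₁, hy₂⟩ := exists_between (lt_min hlt (by linarith : x₀ < x₀ + δ))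
    obtain ⟨hyb, hyδ⟩ := lt_min_iff.1 hy₂
    have hyI : y ∈ Icc a b := ⟨hx₀.1.trans hy₁.le, hyb.le⟩
    obtain ⟨ξ, hξ, hξ'⟩ := exists_hasDerivAt_eq_slope f f' hy₁
      (hcont.mono (Icc_subset_Icc hx₀.1 hyb.le))
      (fun x hx => hder x ⟨hx₀.1.trans_lt hx.1, hx.2.trans hyb⟩)
    have h1 := hsign ξ ⟨hx₀.1.trans hξ.1.le, hξ.2.le.trans hyb.le⟩ hξ.1.ne'
      (by rw [abs_of_pos (sub_pos.2 hξ.1)]; linarith [hξ.2])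
    have h2 : f' ξ ≤ 0 := by
      rw [hξ']
      exact div_nonpos_of_nonpos_of_nonneg (sub_nonpos.2 (hmax hyI)) (by linarith)
    have h3 : 0 < (ξ - x₀)⁻¹ := inv_pos.2 (sub_pos.2 hξ.1)
    nlinarith
  · have hlt : a < x₀ := heq ▸ hab
    obtain ⟨y, hy₁, hy₂⟩ := exists_between (max_lt hlt (by linarith : x₀ - δ < x₀))
    obtain ⟨hya, hyδ⟩ := max_lt_iff.1 hy₁
    have hyI : y ∈ Icc a b := ⟨hya.le, hy₂.le.trans hx₀.2⟩
    obtain ⟨ξ, hξ, hξ'⟩ := exists_hasDerivAt_eq_slope f f' hy₂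
      (hcont.mono (Icc_subset_Icc hya.le hx₀.2))
      (fun x hx => hder x ⟨hya.trans hx.1, hx.2.trans_le hx₀.2⟩)
    have h1 := hsign ξ ⟨hya.le.trans hξ.1.le, hξ.2.le.trans hx₀.2⟩ hξ.2.ne
      (by rw [abs_of_neg (sub_neg.2 hξ.2)]; linarith [hξ.1])
    have h2 : 0 ≤ f' ξ := by
      rw [hξ']
      exact div_nonneg (sub_nonneg.2 (hmax hyI)) (by linarith)
    have h3 : (ξ - x₀)⁻¹ < 0 := inv_lt_zero.2 (sub_neg.2 hξ.2)
    nlinarith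

theorem deriv_nonneg_of_forall_le_right {f : ℝ → ℝ} {c : ℝ} (hab : a < b)
    (hf : HasDerivWithinAt f c (Ico a b) b) (hle : ∀ s ∈ Ico a b, f s ≤ f b) : 0 ≤ c := by
  have htend := (hasDerivWithinAt_iff_tendsto_slope' (by simp)).1 hf
  have : (𝓝[Ico a b] b).NeBot := by
    rw [← mem_closure_iff_nhdsWithin_neBot, closure_Ico hab.ne]
    exact right_mem_Icc.2 hab.le
  refine ge_of_tendsto htend ?_
  filter_upwards [self_mem_nhdsWithin] with s hs
  rw [slope_def_field]
  exact div_nonneg_of_nonpos (by linarith [hle s hs]) (by linarith [hs.2])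

variable {v w w' g : ℝ → ℝ} {x₀ : ℝ}

theorem differentiableAt_deriv_of_contDiffOn (hv : ContDiffOn ℝ (⊤ : ℕ∞) v (Ioo (-1 : ℝ) 1)) {s : ℝ}
    (hs : s ∈ Ioo (-1 : ℝ) 1) : DifferentiableAt ℝ (deriv v) s :=
  ((hv.deriv_of_isOpen (m := (⊤ : ℕ∞)) isOpen_Ioo (by simp)).differentiableOn (by simp)
    s hs).differentiableAt (isOpen_Ioo.mem_nhds hs)

/-- An identity `g = v'(w) w'` inside an interval extends to its end points. -/
theorem flux_eq_of_mem_Icc (hab : a < b) (hv : ContDiffOn ℝ (⊤ : ℕ∞) v (Ioo (-1 : ℝ) 1))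
    (hx₀ : x₀ ∈ Icc a b) (hw : ContinuousWithinAt w (Icc a b) x₀)
    (hw' : ContinuousWithinAt w' (Icc a b) x₀) (hg : ContinuousWithinAt g (Icc a b) x₀)
    (hwx₀ : w x₀ ∈ Ioo (-1 : ℝ) 1) (heq : ∀ x ∈ Ioo a b, g x = deriv v (w x) * w' x) :
    g x₀ = deriv v (w x₀) * w' x₀ := by
  have := nhdsWithin_Ioo_neBot_of_mem_Icc hab hx₀
  have hdv : ContinuousAt (deriv v) (w x₀) :=
    (differentiableAt_deriv_of_contDiffOn hv hwx₀).continuousAt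
  refine tendsto_nhds_unique_of_eventuallyEq (hg.mono Ioo_subset_Icc_self)
    (((hdv.comp_continuousWithinAt hw).mul hw').mono Ioo_subset_Icc_self) ?_
  filter_upwards [self_mem_nhdsWithin] with x hx using heq x hx

/-- Differentiating `g = v'(w) w'` at a critical point of `w`. -/
theorem deriv_flux_of_critical (hab : a < b) (hv : ContDiffOn ℝ (⊤ : ℕ∞) v (Ioo (-1 : ℝ) 1))
    (hx₀ : x₀ ∈ Icc a b) {c e : ℝ} (hw : HasDerivWithinAt w (w' x₀) (Icc a b) x₀)
    (hw' : HasDerivWithinAt w' c (Icc a b) x₀) (hg : HasDerivWithinAt g e (Icc a b) x₀)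
    (hwx₀ : w x₀ ∈ Ioo (-1 : ℝ) 1) (heq : ∀ x ∈ Ioo a b, g x = deriv v (w x) * w' x)
    (hcrit : w' x₀ = 0) : e = deriv v (w x₀) * c := by
  have hdv := (differentiableAt_deriv_of_contDiffOn hv hwx₀).hasDerivAt
  have hflux := ((hdv.comp_hasDerivWithinAt x₀ hw).mul hw').mono Ioo_subset_Icc_self
  have hg' := hflux.congr heq (flux_eq_of_mem_Icc hab hv hx₀ hw.continuousWithinAt
    hw'.continuousWithinAt hg.continuousWithinAt hwx₀ heq)
  have huniq : UniqueDiffWithinAt ℝ (Ioo a b) x₀ := by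
    refine uniqueDiffWithinAt_convex (convex_Ioo a b) ?_ ?_
    · simpa using hab
    · rwa [closure_Ioo hab.ne]
  simpa [hcrit] using huniq.eq_deriv _ (hg.mono Ioo_subset_Icc_self) hg'

/-- If `p` agrees with `w` inside the interval and jumps at `x₀`, then `v ∘ p` is not differentiable
at `x₀`, so `g x₀ = deriv (v ∘ p) x₀` vanishes and `x₀` is a critical point of `w`. -/
theorem critical_of_jump (hab : a < b) (hv : ContDiffOn ℝ (⊤ : ℕ∞) v (Ioo (-1 : ℝ) 1))
    (hv' : ∀ s ∈ Ioo (-1 : ℝ) 1, 0 < deriv v s)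
    (hx₀ : x₀ ∈ Icc a b) (hw : ContinuousWithinAt w (Icc a b) x₀)
    (hw' : ContinuousWithinAt w' (Icc a b) x₀) (hg : ContinuousWithinAt g (Icc a b) x₀)
    (hwx₀ : w x₀ ∈ Ioo (-1 : ℝ) 1) (heq : ∀ x ∈ Ioo a b, g x = deriv v (w x) * w' x)
    {p : ℝ → ℝ} (hp : ∀ x ∈ Ioo a b, p x = w x) (hpx₀ : p x₀ ∈ Ioo (-1 : ℝ) 1)
    (hjump : p x₀ ≠ w x₀) (hgx₀ : g x₀ = deriv (fun x => v (p x)) x₀) : w' x₀ = 0 := by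
  have := nhdsWithin_Ioo_neBot_of_mem_Icc hab hx₀
  have hmono : StrictMonoOn v (Ioo (-1 : ℝ) 1) :=
    strictMonoOn_of_deriv_pos (convex_Ioo _ _) hv.continuousOn (by simpa using hv')
  have hnd : ¬ DifferentiableAt ℝ (fun x => v (p x)) x₀ := by
    intro hd
    have hvw : ContinuousWithinAt (fun x => v (w x)) (Icc a b) x₀ :=
      (hv.continuousOn.continuousAt (isOpen_Ioo.mem_nhds hwx₀)).comp_continuousWithinAt hw
    refine hjump (hmono.injOn hpx₀ hwx₀ ?_)
    refine tendsto_nhds_unique_of_eventuallyEq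
      (hd.continuousAt.continuousWithinAt (s := Ioo a b)) (hvw.mono Ioo_subset_Icc_self) ?_
    filter_upwards [self_mem_nhdsWithin] with x hx
    simp only [hp x hx]
  have hzero := flux_eq_of_mem_Icc hab hv hx₀ hw hw' hg hwx₀ heq
  rw [hgx₀, deriv_zero_of_not_differentiableAt hnd] at hzero
  exact (mul_eq_zero.1 hzero.symm).resolve_left (hv' _ hwx₀).ne'

end OneVariable

/-- If `w` exceeds `M` somewhere but not initially, then it first touches a slowly rising barrier at
a spatial maximum, where it increases at a positive rate. -/
theorem exists_first_touching {a b T M x₀ t₀ : ℝ} {w wt : ℝ × ℝ → ℝ}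
    (hw : ContinuousOn w (Icc a b ×ˢ Icc 0 T))
    (hwt : ∀ x ∈ Icc a b, ∀ t ∈ Icc 0 T, HasDerivWithinAt (fun s => w (x, s)) (wt (x, t)) (Icc 0 T) t)
    (hM : M < 1) (hinit : ∀ x ∈ Icc a b, w (x, 0) ≤ M)
    (hx₀ : x₀ ∈ Icc a b) (ht₀ : t₀ ∈ Ico 0 T) (hgt : M < w (x₀, t₀)) :
    ∃ x ∈ Icc a b, ∃ t ∈ Ioo 0 T, M < w (x, t) ∧ w (x, t) < 1 ∧ 0 < wt (x, t) ∧
      IsMaxOn (fun y => w (y, t)) (Icc a b) x := by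
  obtain ⟨N, hMN, hN⟩ := exists_between (lt_min hM hgt)
  have hT : 0 < T := ht₀.1.trans_lt ht₀.2
  obtain ⟨K, hNK, hK⟩ := exists_between hN
  obtain ⟨hK1, hKw⟩ := lt_min_iff.1 hK
  set ε := (K - N) / T
  have hεpos : 0 < ε := div_pos (sub_pos.2 hNK) hT
  have hεT : ε * T = K - N := div_mul_cancel₀ _ hT.ne'
  have hbar : ∀ t ∈ Icc 0 T, N + ε * t ≤ K := fun t ht => by nlinarith [ht.2]
  set φ : ℝ × ℝ → ℝ := fun p => w p - ε * p.2 with hφ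
  have hφc : ContinuousOn φ (Icc a b ×ˢ Icc 0 T) := hw.sub (by fun_prop)
  have hcomp : IsCompact ((Icc a b ×ˢ Icc 0 T) ∩ φ ⁻¹' Ici N) :=
    (isCompact_Icc.prod isCompact_Icc).of_isClosed_subset
      (hφc.preimage_isClosed_of_isClosed (isClosed_Icc.prod isClosed_Icc) isClosed_Ici)
      inter_subset_left
  have hmem₀ : (x₀, t₀) ∈ (Icc a b ×ˢ Icc 0 T) ∩ φ ⁻¹' Ici N := by
    refine ⟨⟨hx₀, Ico_subset_Icc_self ht₀⟩, ?_⟩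
    have := hbar t₀ (Ico_subset_Icc_self ht₀)
    simp only [hφ, mem_preimage, mem_Ici]
    linarith
  obtain ⟨⟨x, t⟩, ⟨⟨hx, ht⟩, hxt⟩, hmin⟩ :=
    hcomp.exists_isMinOn ⟨_, hmem₀⟩ (continuous_snd.continuousOn)
  simp only [hφ, mem_preimage, mem_Ici] at hx ht hxt
  have htt₀ : t ≤ t₀ := hmin hmem₀
  have htT : t < T := htt₀.trans_lt ht₀.2
  have htpos : 0 < t := by
    refine ht.1.lt_of_ne fun h => ?_
    rw [← h] at hxt
    linarith [hinit x hx]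
  have hbefore : ∀ y ∈ Icc a b, ∀ s ∈ Ico 0 t, w (y, s) - ε * s < N := by
    intro y hy s hs
    by_contra! hcon
    exact (hs.2.trans_le (hmin (a := (y, s)) ⟨⟨hy, hs.1, hs.2.le.trans ht.2⟩, hcon⟩)).false
  have hsub : Ico 0 t ⊆ Icc 0 T := fun s hs => ⟨hs.1, hs.2.le.trans ht.2⟩
  have hat : ∀ y ∈ Icc a b, w (y, t) - ε * t ≤ N := by
    intro y hy
    have : (𝓝[Ico 0 t] t).NeBot := by
      rw [← mem_closure_iff_nhdsWithin_neBot, closure_Ico htpos.ne]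
      exact right_mem_Icc.2 htpos.le
    have hc : ContinuousWithinAt (fun s => w (y, s) - ε * s) (Ico 0 t) t :=
      ((hwt y hy t ht).continuousWithinAt.mono hsub).sub (by fun_prop)
    refine le_of_tendsto hc ?_
    filter_upwards [self_mem_nhdsWithin] with s hs using (hbefore y hy s hs).le
  have hval : w (x, t) = N + ε * t := by linarith [hat x hx]
  refine ⟨x, hx, t, ⟨htpos, htT⟩, ?_, ?_, ?_, ?_⟩
  · nlinarith
  · linarith [hbar t ht]
  · have hd : HasDerivWithinAt (fun s => w (x, s) - ε * s) (wt (x, t) - ε * 1) (Ico 0 t) t :=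
      ((hwt x hx t ht).mono hsub).sub ((hasDerivWithinAt_id t _).const_mul ε)
    have := deriv_nonneg_of_forall_le_right htpos hd
      (fun s hs => by linarith [hbefore x hx s hs])
    linarith
  · intro y hy
    have := hat y hy
    simp only [mem_ofPred_eq]
    linarith

/-- One-sided gradient bound for solutions of `u_t = (v(u_x))_x`. -/
theorem ux_le_of_parabolic (d T : ℝ) (hd : 0 < d) (hT : 0 < T)
    (v : ℝ → ℝ) (hv : ContDiffOn ℝ (⊤ : ℕ∞) v (Ioo (-1 : ℝ) 1))
    (hv' : ∀ s ∈ Ioo (-1 : ℝ) 1, 0 < deriv v s)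
    (u : ℝ → ℝ → ℝ)
    (hsmooth : ContDiffOn ℝ (⊤ : ℕ∞) (fun p : ℝ × ℝ => u p.1 p.2) (Icc (-d) d ×ˢ Icc 0 T))
    (hspace : ∀ x ∈ Icc (-d) d, ∀ t ∈ Icc (0 : ℝ) T, |ux u x t| < 1)
    (hpde : ∀ x ∈ Icc (-d) d, ∀ t ∈ Icc (0 : ℝ) T,
      ut u x t = deriv (fun y => v (ux u y t)) x)
    {M : ℝ} (hM₀ : 0 ≤ M) (hM₁ : M < 1)
    (hbcm : ∀ t ∈ Icc (0 : ℝ) T, ux u (-d) t ≤ M)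
    (hbcp : ∀ t ∈ Icc (0 : ℝ) T, ux u d t ≤ M)
    (hinit : ∀ x ∈ Icc (-d) d, ux u x 0 ≤ M) :
    ∀ x ∈ Icc (-d) d, ∀ t ∈ Icc (0 : ℝ) T, ux u x t ≤ M := by
  have hdd : -d < d := by linarith
  set S := Icc (-d) d ×ˢ Icc 0 T with hS
  set U : ℝ × ℝ → ℝ := fun p => u p.1 p.2
  have hSu : UniqueDiffOn ℝ S := (uniqueDiffOn_Icc hdd).prod (uniqueDiffOn_Icc hT)
  have hSc : S ⊆ closure (interior S) := by
    rw [hS, interior_prod_eq, interior_Icc, interior_Icc, closure_prod_eq, closure_Ioo hdd.ne,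
      closure_Ioo hT.ne]
  set W := dirDerivWithin S (1, 0) U
  set V := dirDerivWithin S (0, 1) U
  set Wx := dirDerivWithin S (1, 0) W
  have hWs : ContDiffOn ℝ (⊤ : ℕ∞) W S := hsmooth.dirDerivWithin hSu _
  have hVs : ContDiffOn ℝ (⊤ : ℕ∞) V S := hsmooth.dirDerivWithin hSu _
  have hWxs : ContDiffOn ℝ (⊤ : ℕ∞) Wx S := hWs.dirDerivWithin hSu _
  have hUd := hsmooth.differentiableOn (by simp)
  have hWd := hWs.differentiableOn (by simp)
  have hVd := hVs.differentiableOn (by simp)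
  have hWxd := hWxs.differentiableOn (by simp)
  have huxW : ∀ x ∈ Ioo (-d) d, ∀ t ∈ Icc 0 T, ux u x t = W (x, t) := fun x hx t ht =>
    ((hasDerivWithinAt_fst hUd (Ioo_subset_Icc_self hx) ht).hasDerivAt
      (Icc_mem_nhds hx.1 hx.2)).deriv
  have hutV : ∀ x ∈ Icc (-d) d, ∀ t ∈ Ioo 0 T, ut u x t = V (x, t) := fun x hx t ht =>
    ((hasDerivWithinAt_snd hUd hx (Ioo_subset_Icc_self ht)).hasDerivAt
      (Icc_mem_nhds ht.1 ht.2)).deriv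
  have heq : ∀ t ∈ Ioo 0 T, ∀ x ∈ Ioo (-d) d, V (x, t) = deriv v (W (x, t)) * Wx (x, t) := by
    intro t ht x hx
    have hxI := Ioo_subset_Icc_self hx
    have htI := Ioo_subset_Icc_self ht
    have hWx1 : HasDerivAt (fun y => W (y, t)) (Wx (x, t)) x :=
      (hasDerivWithinAt_fst hWd hxI htI).hasDerivAt (Icc_mem_nhds hx.1 hx.2)
    have hmem : W (x, t) ∈ Ioo (-1 : ℝ) 1 := by
      rw [← huxW x hx t htI]
      exact abs_lt.1 (hspace x hxI t htI)
    have hvd : HasDerivAt v (deriv v (W (x, t))) (W (x, t)) :=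
      ((hv.differentiableOn (by simp) _ hmem).differentiableAt
        (isOpen_Ioo.mem_nhds hmem)).hasDerivAt
    rw [← hutV x hxI t ht, hpde x hxI t htI]
    refine ((hvd.comp x hWx1).congr_of_eventuallyEq ?_).deriv
    filter_upwards [isOpen_Ioo.mem_nhds hx] with y hy
    simp [huxW y hy t htI]
  have hWinit : ∀ x ∈ Icc (-d) d, W (x, 0) ≤ M := by
    intro x hx
    have h0 : (0 : ℝ) ∈ Icc 0 T := ⟨le_rfl, hT.le⟩
    have := nhdsWithin_Ioo_neBot_of_mem_Icc hdd hx
    refine le_of_tendsto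
      ((hasDerivWithinAt_fst hWd hx h0).continuousWithinAt.mono Ioo_subset_Icc_self) ?_
    filter_upwards [self_mem_nhdsWithin] with y hy
    rw [← huxW y hy 0 h0]
    exact hinit y (Ioo_subset_Icc_self hy)
  have hWle : ∀ x ∈ Icc (-d) d, ∀ t ∈ Ico 0 T, W (x, t) ≤ M := by
    intro x₀ hx₀ t₀ ht₀
    by_contra! hgt
    obtain ⟨x, hx, t, ht, hMW, hW1, hWt, hmax⟩ := exists_first_touching hWs.continuousOn
      (fun x hx t ht => hasDerivWithinAt_snd hWd hx ht) hM₁ hWinit hx₀ ht₀ hgt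
    have htI := Ioo_subset_Icc_self ht
    have hmem : W (x, t) ∈ Ioo (-1 : ℝ) 1 := ⟨by linarith, hW1⟩
    have hw := fun y (hy : y ∈ Icc (-d) d) => hasDerivWithinAt_fst hWd hy htI
    have hw' := hasDerivWithinAt_fst hWxd hx htI
    have hg := hasDerivWithinAt_fst hVd hx htI
    have hcrit : Wx (x, t) = 0 := by
      by_cases hjump : ux u x t = W (x, t)
      · have hxne : x ∈ Ioo (-d) d := by
          refine ⟨hx.1.lt_of_ne ?_, hx.2.lt_of_ne ?_⟩ <;> intro h
          · rw [← h] at hjump hMW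
            linarith [hbcm t htI]
          · rw [h] at hjump hMW
            linarith [hbcp t htI]
        have hnhds := Icc_mem_nhds hxne.1 hxne.2
        exact (hmax.isLocalMax hnhds).hasDerivAt_eq_zero ((hw x hx).hasDerivAt hnhds)
      · exact critical_of_jump (g := fun y => V (y, t)) (w := fun y => W (y, t))
          (w' := fun y => Wx (y, t)) (p := fun y => ux u y t) hdd hv hv' hx
          (hw x hx).continuousWithinAt hw'.continuousWithinAt hg.continuousWithinAt hmem
          (heq t ht) (fun y hy => huxW y hy t htI) (abs_lt.1 (hspace x hx t htI)) hjump
          (by rw [← hutV x hx t ht, hpde x hx t htI])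
    have hWxx := second_deriv_nonpos_of_isMaxOn (f' := fun y => Wx (y, t)) hdd hx hw hw' hcrit hmax
    have hlin := deriv_flux_of_critical (g := fun y => V (y, t)) (w := fun y => W (y, t))
      (w' := fun y => Wx (y, t)) hdd hv hx (hw x hx) hw' hg hmem (heq t ht) hcrit
    have hcomm := dirDerivWithin_comm hSu (0, 1) (1, 0) hsmooth (p := (x, t)) ⟨hx, htI⟩
      (hSc ⟨hx, htI⟩)
    have hprod := mul_nonpos_of_nonneg_of_nonpos (hv' _ hmem).le hWxx
    have : dirDerivWithin S (0, 1) W (x, t) ≤ 0 := (hcomm.trans hlin).trans_le hprod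
    linarith
  intro x hx t ht
  rcases hx.1.eq_or_lt with h | hxl
  · exact h ▸ hbcm t ht
  rcases hx.2.eq_or_lt with h | hxr
  · exact h ▸ hbcp t ht
  rw [huxW x ⟨hxl, hxr⟩ t ht]
  have : (𝓝[Ico 0 T] t).NeBot := by
    rw [← mem_closure_iff_nhdsWithin_neBot, closure_Ico hT.ne]
    exact ht
  refine le_of_tendsto
    ((hasDerivWithinAt_snd hWd hx ht).continuousWithinAt.mono Ico_subset_Icc_self) ?_
  filter_upwards [self_mem_nhdsWithin] with s hs using hWle x hx s hs

theorem stmt_11 (d θm θp T : ℝ) (hd : 0 < d) (hT : 0 < T)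
    (hθm : θm ∈ Set.Ioo (-1 : ℝ) 1) (hθp : θp ∈ Set.Ioo (-1 : ℝ) 1)
    (v : ℝ → ℝ) (hv : ContDiffOn ℝ (⊤ : ℕ∞) v (Set.Ioo (-1 : ℝ) 1))
    (hv' : ∀ s ∈ Set.Ioo (-1 : ℝ) 1, 0 < deriv v s)
    (u : ℝ → ℝ → ℝ)
    (hsmooth : ContDiffOn ℝ (⊤ : ℕ∞) (fun p : ℝ × ℝ => u p.1 p.2) (Set.Icc (-d) d ×ˢ Set.Icc 0 T))
    (hspace : ∀ x ∈ Set.Icc (-d) d, ∀ t ∈ Set.Icc (0 : ℝ) T, |ux u x t| < 1)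
    (hpde : ∀ x ∈ Set.Icc (-d) d, ∀ t ∈ Set.Icc (0 : ℝ) T,
      ut u x t = deriv (fun y => v (ux u y t)) x)
    (hbcm : ∀ t ∈ Set.Icc (0 : ℝ) T, ux u (-d) t = θm)
    (hbcp : ∀ t ∈ Set.Icc (0 : ℝ) T, ux u d t = θp)
    (hinit : sSup ((fun y => |ux u y 0|) '' Set.Icc (-d) d) < 1) :
    ∀ x ∈ Set.Icc (-d) d, ∀ t ∈ Set.Icc (0 : ℝ) T,
      |ux u x t| ≤ sSup ((fun y => |ux u y 0|) '' Set.Icc (-d) d) ∧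
        sSup ((fun y => |ux u y 0|) '' Set.Icc (-d) d) < 1 := by
  have hdd : -d ≤ d := by linarith
  have h0 : (0 : ℝ) ∈ Icc 0 T := ⟨le_rfl, hT.le⟩
  have hbdd : BddAbove ((fun y => |ux u y 0|) '' Icc (-d) d) := by
    refine ⟨1, ?_⟩
    rintro _ ⟨y, hy, rfl⟩
    exact (hspace y hy 0 h0).le
  set M := sSup ((fun y => |ux u y 0|) '' Icc (-d) d)
  have hle : ∀ y ∈ Icc (-d) d, |ux u y 0| ≤ M := fun y hy => le_csSup hbdd ⟨y, hy, rfl⟩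
  have hl : |θm| ≤ M := by simpa [hbcm 0 h0] using hle (-d) (left_mem_Icc.2 hdd)
  have hr : |θp| ≤ M := by simpa [hbcp 0 h0] using hle d (right_mem_Icc.2 hdd)
  have hM₀ : 0 ≤ M := (abs_nonneg _).trans hl
  have huxneg : ∀ x t, ux (fun x t => -u x t) x t = -ux u x t := fun x t => deriv.fun_neg
  have hutneg : ∀ x t, ut (fun x t => -u x t) x t = -ut u x t := fun x t => deriv.fun_neg
  have hmaps : MapsTo (fun s : ℝ => -s) (Ioo (-1) 1) (Ioo (-1) 1) :=
    fun s hs => ⟨by linarith [hs.2], by linarith [hs.1]⟩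
  have hupper := ux_le_of_parabolic d T hd hT v hv hv' u hsmooth hspace hpde hM₀ hinit
    (fun t ht => hbcm t ht ▸ (le_abs_self _).trans hl)
    (fun t ht => hbcp t ht ▸ (le_abs_self _).trans hr)
    (fun x hx => (le_abs_self _).trans (hle x hx))
  have hlower := ux_le_of_parabolic d T hd hT (fun s => -v (-s))
    (hv.comp contDiff_neg.contDiffOn hmaps).neg
    (fun s hs => by
      rw [deriv.fun_neg, deriv_comp_neg, neg_neg]
      exact hv' _ (hmaps hs))
    (fun x t => -u x t) hsmooth.neg
    (fun x hx t ht => by simpa [huxneg] using hspace x hx t ht)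
    (fun x hx t ht => by
      simp only [huxneg, hutneg, neg_neg, deriv.fun_neg]
      rw [hpde x hx t ht])
    hM₀ hinit
    (fun t ht => by simpa [huxneg, hbcm t ht] using (neg_le_abs _).trans hl)
    (fun t ht => by simpa [huxneg, hbcp t ht] using (neg_le_abs _).trans hr)
    (fun x hx => by simpa [huxneg] using (neg_le_abs _).trans (hle x hx))
  intro x hx t ht
  refine ⟨abs_le'.2 ⟨hupper x hx t ht, ?_⟩, hinit⟩
  simpa only [huxneg] using hlower x hx t ht
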